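/- Let p>1 and let w be a weight on a dyadic interval J with [w]_{RH_p^d(J)} = δ and Q := max{Db^d(w), 2}. Let ε = ε(p,δ,Q) and s^- := u^-(1/ε). Then for every q > 1 − s^-, the weight w belongs to the dyadic Muckenhoupt class A_q^d on J, and moreover [w]_{A_q^d(J)} ≤ ((q−1)/(q−1+s^-))^{q−1}. -/

import Mathlib

open MeasureTheory Set

/-- The dyadic interval `[n·2^(-k), (n+1)·2^(-k)]`. -/
noncomputable def dIcc (n k : ℕ) : Set ℝ :=
  Set.Icc ((n : ℝ) * 2 ^ (-(k : ℤ))) (((n : ℝ) + 1) * 2 ^ (-(k : ℤ)))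

/-- The average `⟨f⟩_I` of `f` over the dyadic interval `I = [n·2^(-k), (n+1)·2^(-k)]`. -/
noncomputable def avg (f : ℝ → ℝ) (n k : ℕ) : ℝ :=
  (2 : ℝ) ^ (k : ℤ) * ∫ x in dIcc n k, f x


noncomputable def phiF (p k x y z : ℝ) : ℝ := y * z ^ p - k * x * z + (k - 1)

noncomputable def GF (p k r x y z : ℝ) : ℝ :=
  (k - 1) / r * z ^ r - k * x / (r + 1) * z ^ (r + 1) + y / (r + p) * z ^ (r + p)

lemma phiF_convex {p k x y : ℝ} (hp : 1 < p) (hy : 0 < y) :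
    ConvexOn ℝ (Ici 0) (phiF p k x y) := by
  have h1 : ConvexOn ℝ (Ici (0:ℝ)) (fun z : ℝ => y • z ^ p) :=
    (convexOn_rpow hp.le).smul hy.le
  refine ⟨convex_Ici 0, ?_⟩
  intro a ha b hb t u ht hu htu
  have := h1.2 ha hb ht hu htu
  simp only [smul_eq_mul, phiF] at *
  have e : k - 1 = t * (k-1) + u * (k-1) := by rw [← add_mul, htu, one_mul]
  nlinarith

lemma GF_deriv {p k r x y z : ℝ} (hp : 1 < p) (hr : 0 < r) (hz : 0 < z) :
    HasDerivAt (GF p k r x y) (z ^ (r - 1) * phiF p k x y z) z := by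
  have h1 := (Real.hasDerivAt_rpow_const (x := z) (p := r) (Or.inl hz.ne')).const_mul ((k-1)/r)
  have h2 := (Real.hasDerivAt_rpow_const (x := z) (p := r+1) (Or.inl hz.ne')).const_mul (k*x/(r+1))
  have h3 := (Real.hasDerivAt_rpow_const (x := z) (p := r+p) (Or.inl hz.ne')).const_mul (y/(r+p))
  refine ((h1.sub h2).add h3).congr_deriv ?_
  have e1 : z ^ (r + 1 - 1) = z ^ (r-1) * z := by
    rw [show r + 1 - 1 = (r - 1) + 1 by ring, Real.rpow_add hz, Real.rpow_one]
  have e2 : z ^ (r + p - 1) = z ^ (r-1) * z ^ p := by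
    rw [show r + p - 1 = (r - 1) + p by ring, Real.rpow_add hz]
  rw [e1, e2, phiF]
  have : r + 1 ≠ 0 := by positivity
  have : r + p ≠ 0 := by positivity
  field_simp
  ring

lemma rpow_tangent {p a b : ℝ} (hp : 1 < p) (ha : 0 < a) (hb : 0 < b) :
    a ^ p * (1 + p * (b / a - 1)) ≤ b ^ p := by
  have h := one_add_mul_self_le_rpow_one_add (s := b / a - 1) (by have : 0 < b / a := by positivity
                                                                  linarith) hp.le
  have e : b ^ p = a ^ p * (1 + (b/a - 1)) ^ p := by
    rw [← Real.mul_rpow ha.le (by have : 0 < b / a := by positivity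
                                  linarith)]
    congr 1; field_simp; ring
  rw [e]
  exact mul_le_mul_of_nonneg_left h (by positivity)

lemma GF_min {p k r x y zs z : ℝ} (hp : 1 < p) (hr : 0 < r) (hy : 0 < y)
    (hzs : 0 < zs) (h0 : phiF p k x y zs = 0) (h1 : p * (k - 1) ≤ k * (p - 1) * (x * zs))
    (hz : 0 < z) (h : zs ≤ z ∨ phiF p k x y z ≤ 0) :
    GF p k r x y zs ≤ GF p k r x y z := by
  have hc : ∀ a b : ℝ, 0 < a → ContinuousOn (GF p k r x y) (Icc a b) := fun a b ha t ht =>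
    (GF_deriv hp hr (lt_of_lt_of_le ha ht.1)).continuousAt.continuousWithinAt
  rcases le_or_gt zs z with hzz | hzz
  · refine monotoneOn_of_deriv_nonneg (convex_Icc zs z) (hc _ _ hzs) ?_ ?_
      (left_mem_Icc.2 hzz) (right_mem_Icc.2 hzz) hzz
    · intro t ht
      rw [interior_Icc] at ht
      exact (GF_deriv hp hr (hzs.trans ht.1)).differentiableAt.differentiableWithinAt
    · intro t ht
      rw [interior_Icc] at ht
      have htp := hzs.trans ht.1
      rw [(GF_deriv hp hr htp).deriv]
      refine mul_nonneg (by positivity) ?_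
      have h2 := mul_le_mul_of_nonneg_left (rpow_tangent hp hzs htp) hy.le
      have hd : 0 < t / zs - 1 := by
        rw [sub_pos, lt_div_iff₀ hzs]; linarith [ht.1]
      have e : t = zs * (1 + (t/zs - 1)) := by field_simp; ring
      set d := t / zs - 1
      have e3 : k * x * t = k * x * zs + k * x * zs * d := by
        conv_lhs => rw [e]
        ring
      unfold phiF at h0 ⊢
      rw [e3]
      have e4 : y * zs ^ p = k * x * zs - (k-1) := by linarith
      have : y * (zs ^ p * (1 + p * d)) = (k * x * zs - (k-1)) * (1 + p * d) := by
        rw [← e4]; ring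
      nlinarith
  · have hφ : phiF p k x y z ≤ 0 := by
      rcases h with h | h
      · linarith
      · exact h
    refine antitoneOn_of_deriv_nonpos (convex_Icc z zs) (hc _ _ hz) ?_ ?_
      (left_mem_Icc.2 hzz.le) (right_mem_Icc.2 hzz.le) hzz.le
    · intro t ht
      rw [interior_Icc] at ht
      exact (GF_deriv hp hr (hz.trans ht.1)).differentiableAt.differentiableWithinAt
    · intro t ht
      rw [interior_Icc] at ht
      have htp := hz.trans ht.1
      rw [(GF_deriv hp hr htp).deriv]
      refine mul_nonpos_of_nonneg_of_nonpos (by positivity) ?_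
      have := (phiF_convex (k := k) (x := x) hp hy).le_max_of_mem_Icc (x := z) (y := zs) (z := t)
        hz.le hzs.le ⟨ht.1.le, ht.2.le⟩
      rw [h0, max_eq_right hφ] at this
      exact this

/-- value at the reciprocal of `(1-s) x` -/
lemma phiF_z0 {p s E x y k : ℝ} (hp : 1 < p) (hs : s ≤ 0) (hE : E * (1 - p * s) = (1 - s) ^ p)
    (hk : k = p * (1 - s) / (1 - p * s)) (hx : 0 < x) (hy : y ≤ E * x ^ p) :
    phiF p k x y (((1 - s) * x)⁻¹) ≤ 0 := by
  have h1 : 0 < 1 - s := by linarith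
  have h2 : 0 < 1 - p * s := by nlinarith
  have e : ((((1 - s) * x)⁻¹) ^ p) = (E * (1 - p * s) * x ^ p)⁻¹ := by
    rw [Real.inv_rpow (by positivity), Real.mul_rpow h1.le hx.le, hE]
  have hEp : 0 < E := by
    have : 0 < (1-s)^p := by positivity
    rw [← hE] at this
    exact pos_of_mul_pos_left this h2.le
  unfold phiF
  rw [e]
  have hxp : 0 < x ^ p := by positivity
  have h3 : y * (E * (1 - p * s) * x ^ p)⁻¹ ≤ (1 - p * s)⁻¹ := by
    calc _ ≤ (E * x ^ p) * (E * (1 - p * s) * x ^ p)⁻¹ :=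
          mul_le_mul_of_nonneg_right hy (by positivity)
      _ = _ := by field_simp
  have h4 : k * x * ((1 - s) * x)⁻¹ - (k - 1) = (1 - p * s)⁻¹ := by
    rw [hk]; field_simp; ring
  linarith

lemma k_facts {p s k : ℝ} (hp : 1 < p) (hs : s ≤ 0) 
    (hk : k = p * (1 - s) / (1 - p * s)) : 1 < k ∧ p * (k - 1) * (1 - s) = k * (p - 1) := by
  have h1 : 0 < 1 - s := by linarith
  have h2 : 0 < 1 - p * s := by nlinarith
  constructor
  · rw [hk, lt_div_iff₀ h2]; linarith
  · rw [hk]; field_simp; ring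

/-- The selected root. -/
def Root (p s k x y z : ℝ) : Prop :=
  0 < z ∧ phiF p k x y z = 0 ∧ 1 ≤ (1 - s) * (x * z) ∧ x * z ≤ 1

lemma exists_root {p s E x y k : ℝ} (hp : 1 < p) (hs : s ≤ 0)
    (hE : E * (1 - p * s) = (1 - s) ^ p)
    (hk : k = p * (1 - s) / (1 - p * s)) (hx : 0 < x) (hy0 : x ^ p ≤ y) (hy : y ≤ E * x ^ p) :
    ∃ z, Root p s k x y z := by
  have h1 : 0 < 1 - s := by linarith
  have hle : ((1 - s) * x)⁻¹ ≤ x⁻¹ := by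
    apply inv_anti₀ hx; nlinarith
  have hc : ContinuousOn (phiF p k x y) (Icc (((1 - s) * x)⁻¹) x⁻¹) := by
    unfold phiF
    have : Continuous fun z : ℝ => z ^ p := Real.continuous_rpow_const (by linarith)
    fun_prop
  have hr : 0 ≤ phiF p k x y x⁻¹ := by
    unfold phiF
    rw [Real.inv_rpow hx.le]
    have : 1 ≤ y * (x ^ p)⁻¹ := by
      rw [← div_eq_mul_inv, one_le_div (by positivity)]; exact hy0
    have e : k * x * x⁻¹ = k := by field_simp
    rw [e]; linarith
  obtain ⟨z, hz, hz0⟩ := intermediate_value_Icc hle hc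
    (show (0:ℝ) ∈ _ from ⟨phiF_z0 hp hs hE hk hx hy, hr⟩)
  have hzp : 0 < z := lt_of_lt_of_le (by positivity) hz.1
  refine ⟨z, hzp, hz0, ?_, ?_⟩
  · have := mul_le_mul_of_nonneg_left hz.1 (show 0 ≤ (1-s)*x by positivity)
    rw [mul_inv_cancel₀ (by positivity)] at this
    linarith
  · have := mul_le_mul_of_nonneg_left hz.2 hx.le
    rwa [mul_inv_cancel₀ (by positivity)] at this

/-- minimality -/
lemma GF_min_root {p s E r x y k zs z : ℝ} (hp : 1 < p) (hs : s ≤ 0) (hr : 0 < r)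
    (hE : E * (1 - p * s) = (1 - s) ^ p)
    (hk : k = p * (1 - s) / (1 - p * s)) (hx : 0 < x) (hy0 : 0 < y) (hy : y ≤ E * x ^ p)
    (hroot : Root p s k x y zs) (hz : 0 < z)
    (h : 1 ≤ (1 - s) * (x * z) ∨ phiF p k x y z ≤ 0) :
    GF p k r x y zs ≤ GF p k r x y z := by
  obtain ⟨hzs, h0, ha, hb⟩ := hroot
  have h1 : 0 < 1 - s := by linarith
  obtain ⟨k1, k2⟩ := k_facts hp hs hk
  refine GF_min hp hr hy0 hzs h0 ?_ hz ?_
  · rw [← k2]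
    have := mul_le_mul_of_nonneg_left ha (show 0 ≤ p * (k-1) by nlinarith)
    linarith
  · rcases h with h | h
    · rcases le_or_gt zs z with hzz | hzz
      · exact Or.inl hzz
      right
      have hz0 := phiF_z0 hp hs hE hk hx hy
      have := (phiF_convex (k := k) (x := x) hp hy0).le_max_of_mem_Icc
        (x := (((1 - s) * x)⁻¹)) (y := zs) (z := z)
        (by simp only [mem_Ici]; positivity) hzs.le ⟨by
          rw [inv_le_iff_one_le_mul₀ (by positivity)]; linarith, hzz.le⟩
      rwa [h0, max_eq_right hz0] at this
    · exact Or.inr h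

lemma GF_at_root {p s r x y k z : ℝ} (hp : 1 < p) (hs : s ≤ 0) (hr : 0 < r) 
    (hrs : 0 < 1 + r * s)
    (hk : k = p * (1 - s) / (1 - p * s)) (hz : 0 < z) (h0 : phiF p k x y z = 0) :
    ((r + p) * (r * (1 - s) / (1 + r * s)) * (r + 1) / (k * (p - 1))) * GF p k r x y z =
      z ^ r * ((1 + r) / (1 + r * s) - (r * (1 - s) / (1 + r * s)) * (x * z)) := by
  have h1 : 0 < 1 - s := by linarith
  have h2 : 0 < 1 - p * s := by nlinarith
  obtain ⟨k1, k2⟩ := k_facts hp hs hk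
  unfold GF
  have e0 : y * z ^ p = k * x * z - (k-1) := by unfold phiF at h0; linarith
  rw [Real.rpow_add hz, Real.rpow_add hz, Real.rpow_one]
  have e1 : y / (r + p) * (z ^ r * z ^ p) = z ^ r * ((k * x * z - (k-1)) / (r + p)) := by
    rw [← e0]; ring
  rw [e1]
  have hp1 : p - 1 ≠ 0 := by linarith
  have : r + p ≠ 0 := by positivity
  have : p ≠ 0 := by positivity
  rw [hk]
  field_simp
  ring

noncomputable def rhoF (p s k r : ℝ) : ℝ :=
  (r + p) * (r * (1 - s) / (1 + r * s)) * (r + 1) / (k * (p - 1))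

lemma rhoF_pos {p s k r : ℝ} (hp : 1 < p) (hs : s ≤ 0) (hr : 0 < r) (hrs : 0 < 1 + r * s)
    (hk : k = p * (1 - s) / (1 - p * s)) : 0 < rhoF p s k r := by
  have h1 : 0 < 1 - s := by linarith
  obtain ⟨k1, k2⟩ := k_facts hp hs hk
  have : 0 < p - 1 := by linarith
  unfold rhoF
  positivity

lemma B_upper {p s r x y k z : ℝ} (hp : 1 < p) (hs : s ≤ 0) (hr : 0 < r)
    (hrs : 0 < 1 + r * s) (hk : k = p * (1 - s) / (1 - p * s)) (hx : 0 < x)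
    (hroot : Root p s k x y z) :
    rhoF p s k r * GF p k r x y z ≤ x ^ (-r) / (1 + r * s) := by
  obtain ⟨hz, h0, ha, hb⟩ := hroot
  have h1 : 0 < 1 - s := by linarith
  rw [rhoF, GF_at_root hp hs hr hrs hk hz h0, div_eq_mul_inv]
  have hz1 : z ≤ x⁻¹ := by rw [le_inv_comm₀ hz hx, ← one_div, le_div_iff₀ hz]; exact hb
  have e : x ^ (-r) = (x⁻¹) ^ r := by rw [Real.inv_rpow hx.le, Real.rpow_neg hx.le]
  have h3 : z ^ r ≤ x ^ (-r) := by
    rw [e]; exact Real.rpow_le_rpow hz.le hz1 hr.le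
  have h4 : (1 + r) / (1 + r * s) - (r * (1 - s) / (1 + r * s)) * (x * z) ≤ (1 + r * s)⁻¹ := by
    have : (1 + r) / (1 + r * s) - (r * (1 - s) / (1 + r * s)) * (x * z)
        = (1 + r - r * ((1-s) * (x*z))) * (1 + r * s)⁻¹ := by field_simp
    rw [this]
    have h5 : (1 + r - r * ((1-s) * (x*z))) ≤ 1 := by nlinarith
    have := mul_le_mul_of_nonneg_right h5 (show 0 ≤ (1 + r*s)⁻¹ by positivity)
    linarith
  calc _ ≤ z ^ r * (1 + r * s)⁻¹ := mul_le_mul_of_nonneg_left h4 (by positivity)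
    _ ≤ _ := mul_le_mul_of_nonneg_right h3 (by positivity)

lemma B_lower {p s r E x y k z : ℝ} (hp : 1 < p) (hs : s ≤ 0) (hr : 0 < r)
    (hrs : 0 < 1 + r * s) (hE : E * (1 - p * s) = (1 - s) ^ p) (hE1 : 1 ≤ E)
    (hk : k = p * (1 - s) / (1 - p * s)) (hx : 0 < x) (hy : x ^ p ≤ y)
    (hroot : Root p s k x y z) :
    x ^ (-r) ≤ rhoF p s k r * GF p k r x y z := by
  obtain ⟨hz, h0, ha, hb⟩ := hroot
  have h1 : 0 < 1 - s := by linarith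
  have hρ := rhoF_pos hp hs hr hrs hk
  have hxp : 0 < x ^ p := by positivity
  have hxx : x * x⁻¹ = 1 := mul_inv_cancel₀ hx.ne'
  have hroot' : Root p s k x (x ^ p) x⁻¹ := by
    refine ⟨by positivity, ?_, ?_, ?_⟩
    · unfold phiF
      rw [Real.inv_rpow hx.le, mul_inv_cancel₀ hxp.ne', mul_assoc, hxx]; ring
    · rw [hxx]; linarith
    · rw [hxx]
  have hA := GF_min_root hp hs hr hE hk hx hxp (by nlinarith) hroot' hz (Or.inl ha)
  have hB : GF p k r x (x^p) z ≤ GF p k r x y z := by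
    unfold GF
    have : x ^ p / (r + p) * z ^ (r + p) ≤ y / (r + p) * z ^ (r + p) := by gcongr
    linarith
  have hC := GF_at_root hp hs hr hrs hk hroot'.1 hroot'.2.1
  have e : x ^ (-r) = (x⁻¹) ^ r := by rw [Real.inv_rpow hx.le, Real.rpow_neg hx.le]
  have hD : x ^ (-r) = rhoF p s k r * GF p k r x (x^p) x⁻¹ := by
    rw [rhoF, hC, hxx, e]
    field_simp
    ring
  rw [hD]
  exact mul_le_mul_of_nonneg_left (hA.trans hB) hρ.le

/-- The chord condition: `P1 = (x1,y1)` is either to the right of `P=(x,y)`, or the segment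
between them is below the curve. -/
lemma B_side {p s r E x y x1 y1 k z z1 : ℝ} (hp : 1 < p) (hs : s ≤ 0) (hr : 0 < r)
    (hE : E * (1 - p * s) = (1 - s) ^ p)
    (hk : k = p * (1 - s) / (1 - p * s)) (hx : 0 < x) (hyE : y < E * x ^ p)
    (hx1 : 0 < x1) (hy1 : 0 < y1) (hyE1 : y1 ≤ E * x1 ^ p)
    (hseg : x1 < x → ∀ θ : ℝ, 0 ≤ θ → θ ≤ 1 →
      (1 - θ) * y + θ * y1 ≤ E * ((1 - θ) * x + θ * x1) ^ p)
    (hroot : Root p s k x y z) (hroot1 : Root p s k x1 y1 z1) :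
    GF p k r x1 y1 z1 ≤ GF p k r x1 y1 z := by
  obtain ⟨hz, h0, ha, hb⟩ := hroot
  have h1 : 0 < 1 - s := by linarith
  have h2 : 0 < 1 - p * s := by nlinarith
  refine GF_min_root hp hs hr hE hk hx1 hy1 hyE1 hroot1 hz ?_
  by_contra! hcon
  obtain ⟨c1, c2⟩ := hcon
  have hlt : x1 < x := by
    by_contra! hle
    have : (1-s) * (x * z) ≤ (1-s) * (x1*z) := by gcongr
    linarith
  set a := ((1 - s) * z)⁻¹ with hadef
  have haz : (1 - s) * (a * z) = 1 := by rw [hadef]; field_simp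
  have hxa : a ≤ x := by
    by_contra! hh
    have : (1-s) * (x * z) < (1-s) * (a*z) := by gcongr
    linarith
  have hax : x1 < a := by
    by_contra! hh
    have : (1-s) * (a * z) ≤ (1-s) * (x1*z) := by gcongr
    linarith
  have hap : 0 < a := by positivity
  have hza : ((1 - s) * a)⁻¹ = z := by
    rw [hadef]; field_simp
  rcases hxa.lt_or_eq with hxa | hxa
  · have hd : 0 < x - x1 := by linarith
    set θ := (x - a) / (x - x1) with hθ
    have hθ0 : 0 < θ := div_pos (by linarith) hd
    have hθ1 : θ ≤ 1 := by rw [hθ, div_le_one hd]; linarith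
    have hθx : (1 - θ) * x + θ * x1 = a := by
      rw [hθ]; field_simp; ring
    have h3 := hseg hlt θ hθ0.le hθ1
    rw [hθx] at h3
    have h4 := phiF_z0 hp hs hE hk hap h3
    rw [hza] at h4
    have : phiF p k a ((1 - θ) * y + θ * y1) z =
        (1 - θ) * phiF p k x y z + θ * phiF p k x1 y1 z := by
      rw [← hθx]; unfold phiF; ring
    rw [this, h0] at h4
    have := mul_pos hθ0 c2
    linarith
  · rw [hxa] at hza
    have h4 := phiF_z0 hp hs hE hk hx (le_refl (E * x ^ p))
    rw [hza] at h4
    have : phiF p k x (E * x^p) z = phiF p k x y z + (E * x ^ p - y) * z ^ p := by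
      unfold phiF; ring
    rw [this, h0] at h4
    have : 0 < (E * x ^ p - y) * z ^ p := mul_pos (by linarith) (by positivity)
    linarith

lemma B_step {p s r E x y x1 y1 x2 y2 k z z1 z2 : ℝ} (hp : 1 < p) (hs : s ≤ 0) (hr : 0 < r)
    (hrs : 0 < 1 + r * s) (hE : E * (1 - p * s) = (1 - s) ^ p)
    (hk : k = p * (1 - s) / (1 - p * s)) (hx : 0 < x) (hyE : y < E * x ^ p)
    (hx1 : 0 < x1) (hy1 : 0 < y1) (hyE1 : y1 ≤ E * x1 ^ p)
    (hseg1 : x1 < x → ∀ θ : ℝ, 0 ≤ θ → θ ≤ 1 →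
      (1 - θ) * y + θ * y1 ≤ E * ((1 - θ) * x + θ * x1) ^ p)
    (hx2 : 0 < x2) (hy2 : 0 < y2) (hyE2 : y2 ≤ E * x2 ^ p)
    (hseg2 : x2 < x → ∀ θ : ℝ, 0 ≤ θ → θ ≤ 1 →
      (1 - θ) * y + θ * y2 ≤ E * ((1 - θ) * x + θ * x2) ^ p)
    (hxm : x1 + x2 = 2 * x) (hym : y1 + y2 = 2 * y)
    (hroot : Root p s k x y z) (hroot1 : Root p s k x1 y1 z1) (hroot2 : Root p s k x2 y2 z2) :
    rhoF p s k r * GF p k r x1 y1 z1 + rhoF p s k r * GF p k r x2 y2 z2 ≤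
      2 * (rhoF p s k r * GF p k r x y z) := by
  have hρ := rhoF_pos hp hs hr hrs hk
  have a1 := B_side hp hs hr hE hk hx hyE hx1 hy1 hyE1 hseg1 hroot hroot1
  have a2 := B_side hp hs hr hE hk hx hyE hx2 hy2 hyE2 hseg2 hroot hroot2
  have e : GF p k r x1 y1 z + GF p k r x2 y2 z = 2 * GF p k r x y z := by
    have e1 : x2 = 2 * x - x1 := by linarith
    have e2 : y2 = 2 * y - y1 := by linarith
    unfold GF; rw [e1, e2]; ring
  nlinarith

/-- the constant -/
lemma chord_const {p H t : ℝ} (hp : 1 < p) (hH : p < H) (ht : 0 < t) :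
    1 + H * (t - 1) ≤ ((H / p) * ((p - 1) / (H - 1)) ^ ((p - 1) / p)) ^ p * t ^ p ∧
    1 < ((H / p) * ((p - 1) / (H - 1)) ^ ((p - 1) / p)) ^ p := by
  have hp0 : 0 < p := by linarith
  have hp1 : 0 < p - 1 := by linarith
  have hH1 : 0 < H - 1 := by linarith
  have hH0 : 0 < H := by linarith
  set M := ((H / p) * ((p - 1) / (H - 1)) ^ ((p - 1) / p)) ^ p with hM
  have hMp : 0 < M := by positivity
  set t0 := p * (H - 1) / ((p - 1) * H) with ht0
  have ht0p : 0 < t0 := by positivity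
  have hMt : M * t0 ^ p = (H - 1) / (p - 1) := by
    have e1 : M = (H/p)^p * (((p - 1) / (H - 1)) ^ p * ((p-1)/(H-1))⁻¹) := by
      rw [hM, Real.mul_rpow (by positivity) (by positivity), ← Real.rpow_mul (by positivity),
        div_mul_cancel₀ _ hp0.ne', Real.rpow_sub (by positivity), Real.rpow_one]
      rfl
    rw [e1]
    have e2 : (H/p)^p * (((p - 1) / (H - 1)) ^ p * ((p-1)/(H-1))⁻¹) * t0^p =
        ((H/p) * ((p-1)/(H-1)) * t0) ^ p * ((p-1)/(H-1))⁻¹ := by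
      rw [Real.mul_rpow (by positivity) (by positivity), 
        Real.mul_rpow (by positivity) (by positivity)]
      ring
    have e3 : (H/p) * ((p-1)/(H-1)) * t0 = 1 := by
      rw [ht0]; field_simp
    rw [e2, e3, Real.one_rpow, one_mul, inv_div]
  have key : ∀ t : ℝ, (H - 1) / (p - 1) * (1 + p * (t / t0 - 1)) = 1 + H * (t - 1) := by
    intro t
    rw [ht0]; field_simp; ring
  constructor
  · have h := mul_le_mul_of_nonneg_left (rpow_tangent hp ht0p ht) hMp.le
    rw [← mul_assoc, hMt, key] at h
    exact h
  · have hne : t0 ≠ 1 := by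
      rw [ht0, Ne, div_eq_one_iff_eq (by positivity)]
      intro h; nlinarith
    have hs : (1:ℝ) / t0 - 1 ≠ 0 := by
      intro h
      apply hne
      field_simp at h
      linarith
    have hpos : 0 < 1 / t0 := by positivity
    have h := one_add_mul_self_lt_rpow_one_add (s := 1/t0 - 1) (by linarith) hs hp
    have h' := mul_lt_mul_of_pos_left h (show 0 < (H-1)/(p-1) by positivity)
    rw [key, ← hMt] at h'
    have e : M * t0 ^ p * (1 + (1/t0 - 1)) ^ p = M := by
      rw [mul_assoc, ← Real.mul_rpow (by positivity) (by linarith)]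
      have : t0 * (1 + (1/t0 - 1)) = 1 := by field_simp; ring
      rw [this, Real.one_rpow, mul_one]
    rw [e] at h'
    linarith

lemma H_gt {p Q : ℝ} (hp : 1 < p) (hQ : 1 < Q) : p < (Q ^ p - 1) / (Q - 1) := by
  rw [lt_div_iff₀ (by linarith)]
  have h := one_add_mul_self_lt_rpow_one_add (s := Q - 1) (by linarith) (by linarith) hp
  rw [show 1 + (Q - 1) = Q by ring] at h
  linarith

lemma chord_convex {p Q H t : ℝ} (hp : 1 < p) (hQ : 1 < Q) (hH : H = (Q ^ p - 1) / (Q - 1))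
    (ht1 : 1 ≤ t) (htQ : t ≤ Q) : t ^ p ≤ 1 + H * (t - 1) := by
  have hQ1 : 0 < Q - 1 := by linarith
  have h := @(convexOn_rpow hp.le).2 1 (by simp) Q (by simp; linarith)
    ((Q - t)/(Q-1)) ((t - 1)/(Q-1)) (div_nonneg (by linarith) hQ1.le)
    (div_nonneg (by linarith) hQ1.le) (by field_simp; ring)
  simp only [smul_eq_mul, Real.one_rpow] at h
  have e : (Q - t)/(Q-1) * 1 + (t - 1)/(Q-1) * Q = t := by field_simp; ring
  rw [e] at h
  have e2 : (Q - t)/(Q-1) * 1 + (t - 1)/(Q-1) * Q ^ p = 1 + H * (t - 1) := by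
    rw [hH]; field_simp; ring
  linarith

lemma chord {p Q H D M x y x1 y1 : ℝ} (hp : 1 < p) (hQ : 1 < Q)
    (hH : H = (Q ^ p - 1) / (Q - 1)) (hD : 0 < D)
    (hM : M = ((H / p) * ((p - 1) / (H - 1)) ^ ((p - 1) / p)) ^ p)
    (hx1 : 0 < x1) (hxQ : x ≤ Q * x1) (hy : y ≤ D * x ^ p) (hy1 : y1 ≤ D * x1 ^ p) :
    x1 < x → ∀ θ : ℝ, 0 ≤ θ → θ ≤ 1 →
      (1 - θ) * y + θ * y1 ≤ (M * D) * ((1 - θ) * x + θ * x1) ^ p := by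
  intro hlt θ h0 h1
  have hHp : p < H := by rw [hH]; exact H_gt hp hQ
  have hx : 0 < x := by linarith
  have e1 : x = x1 * (x / x1) := by field_simp
  set τ := x / x1 with hτ
  have hτ1 : 1 ≤ τ := by rw [hτ, le_div_iff₀ hx1]; linarith
  have hτQ : τ ≤ Q := by rw [hτ, div_le_iff₀ hx1]; linarith
  have c := chord_convex hp hQ hH hτ1 hτQ
  have hy' : y ≤ D * x1 ^ p * (1 + H * (τ - 1)) := by
    calc y ≤ D * x ^ p := hy
      _ = D * x1 ^ p * τ ^ p := by rw [e1, Real.mul_rpow hx1.le (by linarith)]; ring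
      _ ≤ _ := mul_le_mul_of_nonneg_left c (by positivity)
  set t := (1 - θ) * τ + θ with ht
  have ht0 : 0 < t := by nlinarith
  have e2 : (1 - θ) * x + θ * x1 = x1 * t := by rw [ht]; nlinarith
  have c2 := (chord_const hp hHp ht0).1
  rw [← hM] at c2
  rw [e2, Real.mul_rpow hx1.le ht0.le]
  have s1 : (1 - θ) * y + θ * y1 ≤ D * x1 ^ p * (1 + H * (t - 1)) := by
    have a := mul_le_mul_of_nonneg_left hy' (show 0 ≤ 1 - θ by linarith)
    have b := mul_le_mul_of_nonneg_left hy1 h0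
    have : D * x1 ^ p * (1 + H * (t - 1)) =
      (1 - θ) * (D * x1 ^ p * (1 + H * (τ - 1))) + θ * (D * x1 ^ p) := by rw [ht]; ring
    linarith
  have s2 := mul_le_mul_of_nonneg_left c2 (show 0 ≤ D * x1 ^ p by positivity)
  calc _ ≤ _ := s1
    _ ≤ _ := s2
    _ = _ := by ring

lemma two_neg_pos (k : ℕ) : (0:ℝ) < 2 ^ (-(k : ℤ)) := by positivity

lemma two_neg_eq (k : ℕ) : (2:ℝ) ^ (-(k : ℤ)) = (2 ^ k)⁻¹ := by
  rw [zpow_neg, zpow_natCast]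

lemma two_neg_succ (k : ℕ) : (2:ℝ) ^ (-((k + 1 : ℕ) : ℤ)) = 2 ^ (-(k : ℤ)) / 2 := by
  rw [two_neg_eq, two_neg_eq, pow_succ]; field_simp

lemma two_pos_eq (k : ℕ) : (2:ℝ) ^ (k : ℤ) = (2 ^ (-(k : ℤ)))⁻¹ := by
  rw [zpow_neg, inv_inv]

lemma dIcc_volume (n k : ℕ) : volume (dIcc n k) = ENNReal.ofReal (2 ^ (-(k : ℤ))) := by
  rw [dIcc, Real.volume_Icc]; congr 1; ring

lemma dIcc_split (n k : ℕ) : dIcc n k = dIcc (2 * n) (k + 1) ∪ dIcc (2 * n + 1) (k + 1) := by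
  unfold dIcc
  rw [two_neg_succ]
  have h := two_neg_pos k
  push_cast
  have e1 : (2 * (n:ℝ) + 1) * (2 ^ (-(k : ℤ)) / 2) = ((n:ℝ) + 1/2) * 2 ^ (-(k : ℤ)) := by ring
  rw [Icc_union_Icc_eq_Icc]
  · congr 1 <;> ring
  · gcongr; linarith
  · gcongr; linarith

lemma avg_split {f : ℝ → ℝ} (hf : LocallyIntegrable f volume) (n k : ℕ) :
    avg f (2 * n) (k + 1) + avg f (2 * n + 1) (k + 1) = 2 * avg f n k := by
  unfold avg
  rw [dIcc_split n k]
  have hi : ∀ n k, IntegrableOn f (dIcc n k) volume := fun n k =>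
    hf.integrableOn_isCompact isCompact_Icc
  have hm : NullMeasurableSet (dIcc (2 * n + 1) (k + 1)) volume :=
    measurableSet_Icc.nullMeasurableSet
  rw [setIntegral_union₀ _ hm (hi _ _) (hi _ _)]
  · push_cast
    rw [zpow_add₀ (by norm_num)]
    ring
  · unfold AEDisjoint
    refine measure_mono_null (t := {((2 * (n:ℝ) + 1) * 2 ^ (-((k + 1 : ℕ) : ℤ)))}) ?_ (by simp)
    rintro t ⟨h1, h2⟩
    unfold dIcc at h1 h2
    push_cast at h1 h2
    simp only [mem_singleton_iff]
    push_cast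
    exact le_antisymm h1.2 h2.1

lemma avg_eq_average (f : ℝ → ℝ) (n k : ℕ) : avg f n k = ⨍ x in dIcc n k, f x := by
  rw [setAverage_eq, avg, two_pos_eq, measureReal_def, dIcc_volume,
    ENNReal.toReal_ofReal (by positivity), smul_eq_mul]

lemma avg_pos {w : ℝ → ℝ} (hw_loc : LocallyIntegrable w volume)
    (hw_pos : ∀ᵐ t ∂(volume : Measure ℝ), 0 < w t) (n k : ℕ) : 0 < avg w n k := by
  unfold avg
  refine mul_pos (by positivity) ?_
  rw [setIntegral_pos_iff_support_of_nonneg_ae]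
  · have : volume (Function.support w ∩ dIcc n k) = volume (dIcc n k) := by
      apply measure_congr
      filter_upwards [hw_pos] with t ht
      have : t ∈ Function.support w := ht.ne'
      apply propext
      change (t ∈ Function.support w ∧ t ∈ dIcc n k) ↔ t ∈ dIcc n k
      tauto
    rw [this, dIcc_volume, ENNReal.ofReal_pos]
    exact two_neg_pos k
  · filter_upwards [ae_restrict_of_ae hw_pos] with t ht using ht.le
  · exact hw_loc.integrableOn_isCompact isCompact_Icc

lemma avg_jensen {w : ℝ → ℝ} {p : ℝ} (hp : 1 < p) (hw_loc : LocallyIntegrable w volume)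
    (hwp_loc : LocallyIntegrable (fun t => w t ^ p) volume)
    (hw_pos : ∀ᵐ t ∂(volume : Measure ℝ), 0 < w t) (n k : ℕ) :
    avg w n k ^ p ≤ avg (fun t => w t ^ p) n k := by
  rw [avg_eq_average, avg_eq_average]
  have hc : Continuous fun x : ℝ => x ^ p := Real.continuous_rpow_const (by linarith)
  refine (convexOn_rpow hp.le).map_set_average_le hc.continuousOn isClosed_Ici ?_ ?_ ?_ ?_ ?_
  · rw [dIcc_volume]; simp only [ne_eq, ENNReal.ofReal_eq_zero, not_le]; exact two_neg_pos k
  · rw [dIcc_volume]; simp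
  · filter_upwards [ae_restrict_of_ae hw_pos] with t ht using ht.le
  · exact hw_loc.integrableOn_isCompact isCompact_Icc
  · exact hwp_loc.integrableOn_isCompact isCompact_Icc

lemma mem_dIcc_floor {t : ℝ} (ht : 0 ≤ t) (k : ℕ) : t ∈ dIcc ⌊t * 2 ^ k⌋₊ k := by
  unfold dIcc
  rw [two_neg_eq]
  have h2 : (0:ℝ) < 2 ^ k := by positivity
  have h1 : (0:ℝ) ≤ t * 2 ^ k := by positivity
  constructor
  · rw [← div_eq_mul_inv, div_le_iff₀ h2]; exact Nat.floor_le h1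
  · rw [← div_eq_mul_inv, le_div_iff₀ h2]; exact (Nat.lt_floor_add_one _).le

lemma avg_tendsto {w : ℝ → ℝ} (hw_loc : LocallyIntegrable w volume) :
    ∀ᵐ t ∂(volume : Measure ℝ), 0 ≤ t → ∀ k0 : ℕ, Filter.Tendsto
      (fun d : ℕ => avg w ⌊t * 2 ^ (k0 + d)⌋₊ (k0 + d)) Filter.atTop (nhds (w t)) := by
  filter_upwards [IsUnifLocDoublingMeasure.ae_tendsto_average volume hw_loc 1] with t ht ht0 k0
  have h := ht (l := Filter.atTop) (ι := ℕ)
    (fun d => ((⌊t * 2 ^ (k0 + d)⌋₊ : ℝ) + 1/2) * 2 ^ (-((k0 + d : ℕ) : ℤ)))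
    (fun d => 2 ^ (-((k0 + d : ℕ) : ℤ)) / 2) ?_ ?_
  · refine h.congr fun d => ?_
    rw [avg_eq_average, Real.closedBall_eq_Icc, dIcc]
    congr 3 <;> ring
  · rw [tendsto_nhdsWithin_iff]
    constructor
    · have : Filter.Tendsto (fun d : ℕ => ((2:ℝ)⁻¹) ^ d * (((2:ℝ)⁻¹) ^ k0 / 2)) Filter.atTop (nhds (0 * (((2:ℝ)⁻¹) ^ k0 / 2))) :=
        (tendsto_pow_atTop_nhds_zero_of_lt_one (by norm_num) (by norm_num)).mul_const _
      rw [zero_mul] at this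
      refine this.congr fun d => ?_
      rw [two_neg_eq, ← inv_pow, pow_add]; ring
    · exact Filter.Eventually.of_forall fun d => half_pos (two_neg_pos _)
  · refine Filter.Eventually.of_forall fun d => ?_
    have := mem_dIcc_floor ht0 (k0 + d)
    rw [Real.closedBall_eq_Icc, one_mul]
    unfold dIcc at this
    constructor
    · refine le_trans (le_of_eq ?_) this.1; ring
    · refine le_trans this.2 (le_of_eq ?_); ring

lemma tree_bound {X b : ℕ → ℕ → ℝ} {G : ℕ → ℕ → Prop} 
    (hG : ∀ n k, G n k → G (2 * n) (k + 1) ∧ G (2 * n + 1) (k + 1))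
    (hXb : ∀ n k, G n k → 0 ≤ X n k ∧ X n k ≤ b n k)
    (hb : ∀ n k, G n k → b (2 * n) (k + 1) + b (2 * n + 1) (k + 1) ≤ 2 * b n k) (d : ℕ) :
    ∀ n k, G n k → ∫⁻ t in dIcc n k, ENNReal.ofReal (X ⌊t * 2 ^ (k + d)⌋₊ (k + d)) ≤
      ENNReal.ofReal (2 ^ (-(k : ℤ)) * b n k) := by
  induction d with
  | zero =>
    intro n k h
    have hae : ∀ᵐ t ∂(volume.restrict (dIcc n k)), 
        ENNReal.ofReal (X ⌊t * 2 ^ (k + 0)⌋₊ (k + 0)) = ENNReal.ofReal (X n k) := by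
      have hne : ∀ᵐ t ∂(volume.restrict (dIcc n k)), t ≠ ((n:ℝ) + 1) * 2 ^ (-(k:ℤ)) :=
        ae_restrict_of_ae (Measure.ae_ne volume _)
      filter_upwards [hne, ae_restrict_mem measurableSet_Icc] with t h1 h2
      have h3 : t < ((n:ℝ) + 1) * 2 ^ (-(k:ℤ)) := lt_of_le_of_ne h2.2 h1
      have h4 := h2.1
      have hk : (0:ℝ) < 2 ^ k := by positivity
      rw [two_neg_eq, ← div_eq_mul_inv] at h3 h4
      rw [lt_div_iff₀ hk] at h3
      rw [div_le_iff₀ hk] at h4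
      have : ⌊t * 2 ^ k⌋₊ = n := by
        rw [Nat.floor_eq_iff (le_trans (by positivity) h4)]
        exact ⟨h4, h3⟩
      rw [add_zero, this]
    rw [lintegral_congr_ae hae, setLIntegral_const, dIcc_volume, ← ENNReal.ofReal_mul (hXb n k h).1]
    apply ENNReal.ofReal_le_ofReal
    rw [mul_comm]
    exact mul_le_mul_of_nonneg_left (hXb n k h).2 (two_neg_pos k).le
  | succ d ih =>
    intro n k h
    obtain ⟨g1, g2⟩ := hG n k h
    have b1 := (hXb _ _ g1).1.trans (hXb _ _ g1).2
    have b2 := (hXb _ _ g2).1.trans (hXb _ _ g2).2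
    have i1 := ih _ _ g1
    have i2 := ih _ _ g2
    rw [dIcc_split]
    refine (lintegral_union_le _ _ _).trans ?_
    rw [show k + (d + 1) = k + 1 + d by ring]
    refine (add_le_add i1 i2).trans ?_
    have := two_neg_pos (k+1)
    rw [← ENNReal.ofReal_add (by positivity) (by positivity)]
    apply ENNReal.ofReal_le_ofReal
    have h3 := mul_le_mul_of_nonneg_left (hb n k h) this.le
    rw [two_neg_succ] at h3 ⊢
    linarith

lemma tree_final {w : ℝ → ℝ} {r : ℝ} {b : ℕ → ℕ → ℝ} {G : ℕ → ℕ → Prop}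
    (hw_loc : LocallyIntegrable w volume)
    (hw_pos : ∀ᵐ t ∂(volume : Measure ℝ), 0 < w t)
    (hG : ∀ n k, G n k → G (2 * n) (k + 1) ∧ G (2 * n + 1) (k + 1))
    (hXb : ∀ n k, G n k → avg w n k ^ (-r) ≤ b n k)
    (hb : ∀ n k, G n k → b (2 * n) (k + 1) + b (2 * n + 1) (k + 1) ≤ 2 * b n k) 
    (n k : ℕ) (h : G n k) :
    IntegrableOn (fun t => w t ^ (-r)) (dIcc n k) volume ∧
    avg (fun t => w t ^ (-r)) n k ≤ b n k := by
  have hpos := avg_pos hw_loc hw_pos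
  have hX : ∀ n k, G n k → 0 ≤ avg w n k ^ (-r) ∧ avg w n k ^ (-r) ≤ b n k := fun n k h =>
    ⟨(Real.rpow_pos_of_pos (hpos n k) _).le, hXb n k h⟩
  have hb0 : 0 ≤ b n k := (hX n k h).1.trans (hX n k h).2
  have htb := fun d => tree_bound (X := fun n k => avg w n k ^ (-r)) hG hX hb d n k h
  have hkey : ∫⁻ t in dIcc n k, ENNReal.ofReal (w t ^ (-r)) ≤
      ENNReal.ofReal (2 ^ (-(k : ℤ)) * b n k) := by
    calc ∫⁻ t in dIcc n k, ENNReal.ofReal (w t ^ (-r)) 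
        = ∫⁻ t in dIcc n k, Filter.liminf (fun d : ℕ => 
            ENNReal.ofReal (avg w ⌊t * 2 ^ (k + d)⌋₊ (k + d) ^ (-r))) Filter.atTop := by
          apply lintegral_congr_ae
          filter_upwards [ae_restrict_of_ae hw_pos, ae_restrict_of_ae (avg_tendsto hw_loc),
            ae_restrict_mem measurableSet_Icc] with t h1 h2 h3
          have ht0 : 0 ≤ t := le_trans (by positivity) h3.1
          have h4 := h2 ht0 k
          have h5 := (h4.rpow_const (p := -r) (Or.inl h1.ne'))
          exact ((ENNReal.continuous_ofReal.tendsto _).comp h5).liminf_eq.symm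
      _ ≤ Filter.liminf (fun d : ℕ => ∫⁻ t in dIcc n k,
            ENNReal.ofReal (avg w ⌊t * 2 ^ (k + d)⌋₊ (k + d) ^ (-r))) Filter.atTop := by
          apply lintegral_liminf_le
          intro d
          have h1 : Measurable fun t : ℝ => ⌊t * 2 ^ (k + d)⌋₊ :=
            Nat.measurable_floor.comp (measurable_id.mul_const _)
          have h2 : Measurable fun m : ℕ => ENNReal.ofReal (avg w m (k + d) ^ (-r)) :=
            measurable_of_countable _
          exact h2.comp h1
      _ ≤ _ := by
          refine (Filter.liminf_le_liminf (Filter.Eventually.of_forall htb)).trans ?_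
          simp
  have hmeas : AEStronglyMeasurable (fun t => w t ^ (-r)) (volume.restrict (dIcc n k)) :=
    (hw_loc.aestronglyMeasurable.aemeasurable.pow_const (-r)).aestronglyMeasurable.restrict
  have hnn : 0 ≤ᵐ[volume.restrict (dIcc n k)] fun t => w t ^ (-r) := by
    filter_upwards [ae_restrict_of_ae hw_pos] with t ht
    exact (Real.rpow_pos_of_pos ht _).le
  constructor
  · refine ⟨hmeas, ?_⟩
    rw [hasFiniteIntegral_iff_ofReal hnn]
    exact hkey.trans_lt ENNReal.ofReal_lt_top
  · rw [avg, integral_eq_lintegral_of_nonneg_ae hnn hmeas]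
    have := ENNReal.toReal_mono ENNReal.ofReal_ne_top hkey
    have h2 := two_neg_pos k
    rw [ENNReal.toReal_ofReal (by positivity)] at this
    rw [two_pos_eq, inv_mul_le_iff₀ h2]
    exact this

/-- **`RH_p` vs `A_q` for `w`.**  Let `p>1` and let `w` be a weight on the
dyadic interval `J = [N·2^(-K), (N+1)·2^(-K)]` with `[w]_{RH_p^d(J)} = δ` and
`Q = max{Db^d(w), 2}`.  With `H = (Q^p−1)/(Q−1)`, `ε = (H/p)·((p−1)/(H−1))^((p−1)/p)·δ`
and `s⁻ = u⁻(1/ε)` (the solution `sm ≤ 0` of `(1−p·sm)^(1/p)(1−sm)⁻¹ = 1/ε`),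
for every `q > 1 − s⁻` the weight `w` belongs to `A_q^d(J)`, and moreover
`[w]_{A_q^d(J)} ≤ ((q−1)/(q−1+s⁻))^(q−1)`. -/
theorem stmt1 (p δ Q0 Q H ε sm : ℝ) (hp : 1 < p)
    (N K : ℕ) (w : ℝ → ℝ)
    (hw_loc : LocallyIntegrable w volume)
    (hwp_loc : LocallyIntegrable (fun t => w t ^ p) volume)
    (hw_pos : ∀ᵐ t ∂(volume : Measure ℝ), 0 < w t)
    -- `[w]_{RH_p^d(J)} = δ` : `δ` is the supremum over dyadic subintervals `I ∈ D(J)`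
    -- of `⟨w^p⟩_I^(1/p) / ⟨w⟩_I`
    (hRH : IsLUB {r : ℝ | ∃ j m : ℕ, m < 2 ^ j ∧
      r = (avg (fun t => w t ^ p) (N * 2 ^ j + m) (K + j)) ^ (1 / p) /
            avg w (N * 2 ^ j + m) (K + j)} δ)
    -- `Db^d(w) = Q0` : `Q0` is the supremum of `⟨w⟩_{I*}/⟨w⟩_I` over dyadic intervals `I`
    (hDb : IsLUB {r : ℝ | ∃ n k : ℕ, r = avg w (n / 2) k / avg w n (k + 1)} Q0)
    (hQ : Q = max Q0 2)
    (hH : H = (Q ^ p - 1) / (Q - 1))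
    (hε : ε = H / p * ((p - 1) / (H - 1)) ^ ((p - 1) / p) * δ)
    (hsm_neg : sm ≤ 0)
    (hsm : (1 - p * sm) ^ (1 / p) * (1 - sm)⁻¹ = 1 / ε) :
    ∀ q : ℝ, 1 - sm < q → ∀ j m : ℕ, m < 2 ^ j →
      IntegrableOn (fun t => w t ^ (-(1 / (q - 1)))) (dIcc (N * 2 ^ j + m) (K + j)) volume ∧
      avg w (N * 2 ^ j + m) (K + j) *
          (avg (fun t => w t ^ (-(1 / (q - 1)))) (N * 2 ^ j + m) (K + j)) ^ (q - 1)
        ≤ ((q - 1) / (q - 1 + sm)) ^ (q - 1) := by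

  intro q hq j m hjm
  have hp0 : 0 < p := by linarith
  have hq1 : 0 < q - 1 := by linarith
  set r := 1 / (q - 1) with hr
  have hr0 : 0 < r := by positivity
  have hrs : 0 < 1 + r * sm := by
    have : 1 + r * sm = (q - 1 + sm) / (q - 1) := by rw [hr]; field_simp
    rw [this]; exact div_pos (by linarith) hq1
  have hQ2 : 1 < Q := by rw [hQ]; exact lt_of_lt_of_le (by norm_num) (le_max_right _ _)
  have hpos := avg_pos hw_loc hw_pos
  have hjen := avg_jensen hp hw_loc hwp_loc hw_pos
  have hposp : ∀ n k, 0 < avg (fun t => w t ^ p) n k := fun n k =>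
    lt_of_lt_of_le (Real.rpow_pos_of_pos (hpos n k) _) (hjen n k)
  have hdb : ∀ n k, avg w (n / 2) k ≤ Q * avg w n (k + 1) := by
    intro n k
    have h1 : avg w (n / 2) k / avg w n (k + 1) ≤ Q0 := hDb.1 ⟨n, k, rfl⟩
    have h2 : Q0 ≤ Q := by rw [hQ]; exact le_max_left _ _
    rw [← div_le_iff₀ (hpos _ _)]; exact h1.trans h2
  have hδ : 0 < δ := by
    have h1 := hRH.1 ⟨0, 0, by norm_num, rfl⟩
    refine lt_of_lt_of_le (div_pos (Real.rpow_pos_of_pos (hposp _ _) _) (hpos _ _)) h1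
  let G : ℕ → ℕ → Prop := fun n k => ∃ j m : ℕ, m < 2 ^ j ∧ n = N * 2 ^ j + m ∧ k = K + j
  have hG : ∀ n k, G n k → G (2 * n) (k + 1) ∧ G (2 * n + 1) (k + 1) := by
    rintro n k ⟨j, m, h1, h2, h3⟩
    refine ⟨⟨j + 1, 2 * m, ?_, ?_, ?_⟩, ⟨j + 1, 2 * m + 1, ?_, ?_, ?_⟩⟩
    · rw [pow_succ]; omega
    · rw [pow_succ, h2]; ring
    · omega
    · rw [pow_succ]; omega
    · rw [pow_succ, h2]; ring
    · omega
  have hD : 0 < δ ^ p := by positivity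
  have hup : ∀ n k, G n k → avg (fun t => w t ^ p) n k ≤ δ ^ p * avg w n k ^ p := by
    rintro n k ⟨j, m, h1, rfl, rfl⟩
    have h := hRH.1 ⟨j, m, h1, rfl⟩
    have hx := hpos (N * 2 ^ j + m) (K + j)
    have hy := hposp (N * 2 ^ j + m) (K + j)
    rw [div_le_iff₀ hx] at h
    have h2 := Real.rpow_le_rpow (by positivity) h hp0.le
    rw [← Real.rpow_mul hy.le, one_div_mul_cancel hp0.ne', Real.rpow_one,
      Real.mul_rpow hδ.le hx.le] at h2
    exact h2
  have hHp : p < H := by rw [hH]; exact H_gt hp hQ2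
  set M := ((H / p) * ((p - 1) / (H - 1)) ^ ((p - 1) / p)) ^ p with hM
  have hM1 : 1 < M := (chord_const hp hHp one_pos).2
  have hc0 : 0 < (H / p) * ((p - 1) / (H - 1)) ^ ((p - 1) / p) := by
    have : 0 < p - 1 := by linarith
    have : 0 < H - 1 := by linarith
    have : 0 < H := by linarith
    positivity
  have hs1 : 0 < 1 - sm := by linarith
  have hs2 : 0 < 1 - p * sm := by nlinarith
  have hε0 : 0 < ε := by rw [hε]; positivity
  have hEε : M * δ ^ p = ε ^ p := by rw [hε, Real.mul_rpow hc0.le hδ.le]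
  have hE : (M * δ ^ p) * (1 - p * sm) = (1 - sm) ^ p := by
    rw [hEε]
    have h1 : ε * (1 - p * sm) ^ (1 / p) = 1 - sm := by
      field_simp at hsm
      linarith
    rw [← h1, Real.mul_rpow hε0.le (by positivity), ← Real.rpow_mul hs2.le,
      one_div_mul_cancel hp0.ne', Real.rpow_one]
  have hG0 : G (N * 2 ^ j + m) (K + j) := ⟨j, m, hjm, rfl, rfl⟩
  have hD1 : 1 ≤ δ ^ p := by
    have h1 := (hjen _ _).trans (hup _ _ hG0)
    exact (le_mul_iff_one_le_left (Real.rpow_pos_of_pos (hpos _ _) _)).1 h1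
  have hE1 : 1 ≤ M * δ ^ p := by nlinarith
  have hlt : ∀ n k, G n k → avg (fun t => w t ^ p) n k < (M * δ ^ p) * avg w n k ^ p := by
    intro n k h
    refine lt_of_le_of_lt (hup n k h) ?_
    have := mul_pos hD (Real.rpow_pos_of_pos (hpos n k) p)
    nlinarith
  obtain ⟨κ, hκ⟩ : ∃ κ, κ = p * (1 - sm) / (1 - p * sm) := ⟨_, rfl⟩
  have hex : ∀ n k, ∃ z, G n k → Root p sm κ (avg w n k) (avg (fun t => w t ^ p) n k) z := by
    intro n k
    by_cases h : G n k
    · obtain ⟨z, hz⟩ := exists_root hp hsm_neg hE hκ (hpos n k) (hjen n k) (hlt n k h).le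
      exact ⟨z, fun _ => hz⟩
    · exact ⟨0, fun h' => absurd h' h⟩
  choose z hz using hex
  let b : ℕ → ℕ → ℝ := fun n k =>
    rhoF p sm κ r * GF p κ r (avg w n k) (avg (fun t => w t ^ p) n k) (z n k)
  have hXb : ∀ n k, G n k → avg w n k ^ (-r) ≤ b n k := fun n k h =>
    B_lower hp hsm_neg hr0 hrs hE hE1 hκ (hpos n k) (hjen n k) (hz n k h)
  have hb : ∀ n k, G n k → b (2 * n) (k + 1) + b (2 * n + 1) (k + 1) ≤ 2 * b n k := by
    intro n k h
    obtain ⟨g1, g2⟩ := hG n k h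
    have d1 := hdb (2 * n) k
    have d2 := hdb (2 * n + 1) k
    rw [show 2 * n / 2 = n by omega] at d1
    rw [show (2 * n + 1) / 2 = n by omega] at d2
    exact B_step hp hsm_neg hr0 hrs hE hκ (hpos n k) (hlt n k h)
      (hpos _ _) (hposp _ _) (hlt _ _ g1).le
      (chord hp hQ2 hH hD hM (hpos _ _) d1 (hup n k h) (hup _ _ g1))
      (hpos _ _) (hposp _ _) (hlt _ _ g2).le
      (chord hp hQ2 hH hD hM (hpos _ _) d2 (hup n k h) (hup _ _ g2))
      (avg_split hw_loc n k) (avg_split hwp_loc n k) (hz n k h) (hz _ _ g1) (hz _ _ g2)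
  obtain ⟨f1, f2⟩ := tree_final hw_loc hw_pos hG hXb hb _ _ hG0
  refine ⟨f1, ?_⟩
  have f3 := f2.trans (B_upper hp hsm_neg hr0 hrs hκ (hpos _ _) (hz _ _ hG0))
  have hx := hpos (N * 2 ^ j + m) (K + j)
  have hnn : 0 ≤ avg (fun t => w t ^ (-r)) (N * 2 ^ j + m) (K + j) := by
    unfold avg
    refine mul_nonneg (by positivity) (integral_nonneg_of_ae ?_)
    filter_upwards [ae_restrict_of_ae hw_pos] with t ht
    exact (Real.rpow_pos_of_pos ht _).le
  set x := avg w (N * 2 ^ j + m) (K + j)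
  have f4 := Real.rpow_le_rpow hnn f3 hq1.le
  have f5 := mul_le_mul_of_nonneg_left f4 hx.le
  refine f5.trans (le_of_eq ?_)
  rw [div_eq_mul_inv, Real.mul_rpow (by positivity) (by positivity), ← Real.rpow_mul hx.le]
  have e1 : -r * (q - 1) = -1 := by rw [hr]; field_simp
  have e2 : (1 + r * sm)⁻¹ = (q - 1) / (q - 1 + sm) := by
    rw [hr, ← inv_div]
    congr 1
    field_simp
  rw [e1, e2, Real.rpow_neg_one, ← mul_assoc, mul_inv_cancel₀ hx.ne', one_mul]
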